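/- arXiv:1801.07452 — 3 statements merged into one kernel-verified Lean document; each statement's English description precedes it below -/
import Mathlib

section
/- Let n be a positive integer, σ > 0, and let S be a real symmetric positive semidefinite n×n matrix. Define f : S_n → (−∞,+∞] by f(C) = log det(C⁻¹ + σ²I) if C is positive definite and +∞ otherwise; define T_S : S_n → (−∞,+∞] by T_S(C) = tr((I + σ²C)⁻¹ C S) if C is positive semidefinite and +∞ otherwise; for positive semidefinite C set ∇T_S(C) = (I + σ²C)⁻¹ S (I + σ²C)⁻¹. Let g₀ be the spectral function on S_n associated with some ψ ∈ Γ0(ℝⁿ) invariant under permutations of coordinates, let g₁ ∈ Γ0(S_n), and set F = f + T_S + g₀ + g₁. Assume dom f ∩ dom g₀ ∩ dom g₁ ≠ ∅, f + g₀ + g₁ is coercive, and that the sublevel set E = {C ∈ S_n : F(C) ≤ F(C⁽⁰⁾)} is contained in the relative interior of dom g₀ ∩ dom g₁. Let C⁽⁰⁾ ∈ S_n be positive definite and let (C⁽ˡ⁾)_{l≥0} be any sequence such that for every l ≥ 0, C⁽ˡ⁺¹⁾ is a minimizer over S_n of C ↦ f(C) + tr(∇T_S(C⁽ˡ⁾)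 C) + g₀(C) + g₁(C). Then: (i) the sequence (F(C⁽ˡ⁾))_{l≥0} is nonincreasing and converges to a real number F̂; and (ii) the sequence (C⁽ˡ⁾)_{l≥0} has at least one cluster point. -/
open Matrix Filter Topology Set

noncomputable section

/-- A real matrix is orthogonal. -/
def IsOrth {n : ℕ} (U : Matrix (Fin n) (Fin n) ℝ) : Prop := Uᵀ * U = 1

/-- `d` is a vector of eigenvalues of `C`, i.e. `C = U Diag(d) Uᵀ` for some orthogonal `U`. -/
def IsEigVec {n : ℕ} (C : Matrix (Fin n) (Fin n) ℝ) (d : Fin n → ℝ) : Prop :=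
  ∃ U : Matrix (Fin n) (Fin n) ℝ, IsOrth U ∧ C = U * Matrix.diagonal d * Uᵀ

/-- Invariance under permutations of coordinates. -/
def PermInv {n : ℕ} (φ : (Fin n → ℝ) → EReal) : Prop :=
  ∀ (σ : Equiv.Perm (Fin n)) (d : Fin n → ℝ), φ (d ∘ σ) = φ d

/-- `F` is the spectral function on symmetric matrices associated with `φ`. -/
def IsSpectral {n : ℕ} (F : Matrix (Fin n) (Fin n) ℝ → EReal)
    (φ : (Fin n → ℝ) → EReal) : Prop :=
  PermInv φ ∧ ∀ (C : Matrix (Fin n) (Fin n) ℝ) (d : Fin n → ℝ), IsEigVec C d → F C = φ d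

/-- A function with values in (−∞,+∞] (represented in `EReal`, so it never takes the value ⊥)
which is finite somewhere. -/
def IsProper {α : Type*} (φ : α → EReal) : Prop := (∃ x, φ x ≠ ⊤) ∧ ∀ x, φ x ≠ ⊥

/-- Convexity for extended-real-valued functions. -/
def EConvex {E : Type*} [AddCommGroup E] [Module ℝ E] (φ : E → EReal) : Prop :=
  ∀ (x y : E) (a b : ℝ), 0 ≤ a → 0 ≤ b → a + b = 1 →
    φ (a • x + b • y) ≤ (a : EReal) * φ x + (b : EReal) * φ y

/-- The class Γ₀ : proper, lower semicontinuous, convex functions into (−∞,+∞]. -/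
def Gamma0 {E : Type*} [AddCommGroup E] [Module ℝ E] [TopologicalSpace E]
    (φ : E → EReal) : Prop :=
  IsProper φ ∧ LowerSemicontinuous φ ∧ EConvex φ

/-- Squared Frobenius norm. -/
def frobSq {n : ℕ} (A : Matrix (Fin n) (Fin n) ℝ) : ℝ := ∑ i, ∑ j, (A i j) ^ 2

/-- Frobenius norm. -/
def frobNorm {n : ℕ} (A : Matrix (Fin n) (Fin n) ℝ) : ℝ := Real.sqrt (frobSq A)


open scoped Classical

/-- `f(C) = log det(C⁻¹ + σ²I)` for `C` positive definite, `+∞` otherwise. -/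
def logdetF {n : ℕ} (σ : ℝ) (C : Matrix (Fin n) (Fin n) ℝ) : EReal :=
  if C.PosDef then
    ((Real.log (C⁻¹ + σ ^ 2 • (1 : Matrix (Fin n) (Fin n) ℝ)).det : ℝ) : EReal)
  else ⊤

/-- `T_S(C) = tr((I + σ²C)⁻¹ C S)` for `C` positive semidefinite, `+∞` otherwise. -/
def traceTS {n : ℕ} (σ : ℝ) (S C : Matrix (Fin n) (Fin n) ℝ) : EReal :=
  if C.PosSemidef then ((((1 + σ ^ 2 • C)⁻¹ * C * S).trace : ℝ) : EReal) else ⊤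

/-- `∇T_S(C) = (I + σ²C)⁻¹ S (I + σ²C)⁻¹`. -/
def gradTS {n : ℕ} (σ : ℝ) (S C : Matrix (Fin n) (Fin n) ℝ) :
    Matrix (Fin n) (Fin n) ℝ :=
  (1 + σ ^ 2 • C)⁻¹ * S * (1 + σ ^ 2 • C)⁻¹

open scoped MatrixOrder Matrix.Norms.L2Operator in
lemma aux_factor {n : ℕ} {S : Matrix (Fin n) (Fin n) ℝ} (hS : S.PosSemidef) :
    ∃ B : Matrix (Fin n) (Fin n) ℝ, S = Bᴴ * B := by
  obtain ⟨B, hB⟩ := CStarAlgebra.nonneg_iff_eq_star_mul_self.mp hS.nonneg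
  exact ⟨B, hB⟩

lemma aux_trace_nonneg {n : ℕ} {X S : Matrix (Fin n) (Fin n) ℝ} (hX : X.PosSemidef)
    (hS : S.PosSemidef) : 0 ≤ (X * S).trace := by
  obtain ⟨B, rfl⟩ := aux_factor hS
  rw [← Matrix.mul_assoc, Matrix.trace_mul_comm, ← Matrix.mul_assoc]
  exact (hX.mul_mul_conjTranspose_same B).trace_nonneg

lemma aux_P {n : ℕ} {σ : ℝ} {A : Matrix (Fin n) (Fin n) ℝ}
    (hA : A.PosSemidef) : (1 + σ ^ 2 • A).PosDef :=
  Matrix.PosDef.one.add_posSemidef (hA.smul (sq_nonneg σ))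

lemma aux_T_nonneg {n : ℕ} {σ : ℝ} {S A : Matrix (Fin n) (Fin n) ℝ}
    (hS : S.PosSemidef) (hA : A.PosSemidef) :
    0 ≤ ((1 + σ ^ 2 • A)⁻¹ * A * S).trace := by
  refine aux_trace_nonneg ?_ hS
  have hP := aux_P (σ := σ) hA
  have hu : IsUnit (1 + σ ^ 2 • A).det := (Matrix.isUnit_iff_isUnit_det _).1 hP.isUnit
  have h1 : (A + σ ^ 2 • (A * A)).PosSemidef := by
    refine hA.add (Matrix.PosSemidef.smul ?_ (sq_nonneg σ))
    have := Matrix.posSemidef_conjTranspose_mul_self A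
    rwa [hA.isHermitian.eq] at this
  have h2 := h1.conjTranspose_mul_mul_same (1 + σ ^ 2 • A)⁻¹
  rw [hP.inv.isHermitian.eq] at h2
  have h3 : A + σ ^ 2 • (A * A) = A * (1 + σ ^ 2 • A) := by
    simp [Matrix.mul_add]
  rw [h3, Matrix.mul_assoc, Matrix.mul_assoc, Matrix.mul_nonsing_inv _ hu, Matrix.mul_one] at h2
  exact h2

lemma aux_T_concave {n : ℕ} {σ : ℝ} (hσ : 0 < σ) {S A B : Matrix (Fin n) (Fin n) ℝ}
    (hS : S.PosSemidef) (hA : A.PosSemidef) (hB : B.PosSemidef) :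
    ((1 + σ ^ 2 • B)⁻¹ * B * S).trace ≤ ((1 + σ ^ 2 • A)⁻¹ * A * S).trace
      + (gradTS σ S A * B).trace - (gradTS σ S A * A).trace := by
  have hs : (σ ^ 2) ≠ 0 := by positivity
  have hP := aux_P (σ := σ) hA
  have hQ := aux_P (σ := σ) hB
  unfold gradTS
  have eA : A = (σ ^ 2)⁻¹ • ((1 + σ ^ 2 • A) - 1) := by simp [smul_smul, hs]
  have eB : B = (σ ^ 2)⁻¹ • ((1 + σ ^ 2 • B) - 1) := by simp [smul_smul, hs]
  generalize 1 + σ ^ 2 • A = P at *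
  generalize 1 + σ ^ 2 • B = Q at *
  subst eA eB
  have hu : IsUnit P.det := (Matrix.isUnit_iff_isUnit_det _).1 hP.isUnit
  have hv : IsUnit Q.det := (Matrix.isUnit_iff_isUnit_det _).1 hQ.isUnit
  have h0 := (hQ.posSemidef.conjTranspose_mul_mul_same (Q⁻¹ - P⁻¹))
  rw [(hQ.inv.isHermitian.sub hP.inv.isHermitian).eq] at h0
  have h1 := aux_trace_nonneg h0 hS
  have h2 : (Q⁻¹ - P⁻¹) * Q * (Q⁻¹ - P⁻¹) = Q⁻¹ - P⁻¹ - P⁻¹ + P⁻¹ * Q * P⁻¹ := by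
    rw [Matrix.sub_mul, Matrix.nonsing_inv_mul _ hv, Matrix.sub_mul, Matrix.mul_sub (P⁻¹ * Q),
      Matrix.one_mul, Matrix.mul_assoc P⁻¹ Q Q⁻¹, Matrix.mul_nonsing_inv _ hv, Matrix.mul_one]
    abel
  rw [h2] at h1
  have c1 : (P⁻¹ * S * P⁻¹ * Q).trace = (P⁻¹ * Q * P⁻¹ * S).trace := by
    rw [Matrix.mul_assoc (P⁻¹ * S), Matrix.trace_mul_comm, ← Matrix.mul_assoc]
  have c2 : (P⁻¹ * S * P⁻¹ * P).trace = (P⁻¹ * S).trace := by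
    rw [Matrix.mul_assoc (P⁻¹ * S), Matrix.nonsing_inv_mul _ hu, Matrix.mul_one]
  simp only [Matrix.mul_smul, Matrix.smul_mul, Matrix.trace_smul, Matrix.mul_sub, Matrix.mul_one,
    Matrix.sub_mul, Matrix.add_mul, Matrix.trace_sub, Matrix.trace_add,
    Matrix.nonsing_inv_mul _ hu, Matrix.nonsing_inv_mul _ hv, Matrix.one_mul, smul_eq_mul,
    c1, c2] at h1 ⊢
  have := mul_nonneg (inv_nonneg.2 (sq_nonneg σ)) h1
  linarith

lemma aux_logdet {n : ℕ} {σ : ℝ} (hσ : 0 < σ) {A : Matrix (Fin n) (Fin n) ℝ}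
    (hA : A.PosDef) :
    Real.log ((σ ^ 2) ^ n) ≤
      Real.log (A⁻¹ + σ ^ 2 • (1 : Matrix (Fin n) (Fin n) ℝ)).det := by
  apply Real.log_le_log (by positivity)
  have hM := hA.inv
  generalize A⁻¹ = M at hM
  have h := hM.isHermitian.charpoly_eq
  have h2 := congrArg (Polynomial.eval (-(σ ^ 2))) h
  rw [Matrix.eval_charpoly, Polynomial.eval_prod] at h2
  have h3 : (M + σ ^ 2 • (1 : Matrix (Fin n) (Fin n) ℝ)) =
      - (Matrix.scalar (Fin n) (-(σ ^ 2)) - M) := by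
    rw [neg_sub, map_neg, sub_neg_eq_add]
    congr 1
    ext i j
    simp [Matrix.scalar_apply, Matrix.diagonal_apply, Matrix.one_apply]
  rw [h3, Matrix.det_neg, h2, Fintype.card_fin]
  have : (-1 : ℝ) ^ n = ∏ _i : Fin n, (-1 : ℝ) := by simp
  rw [this, ← Finset.prod_mul_distrib]
  have : (σ ^ 2) ^ n = ∏ _i : Fin n, σ ^ 2 := by simp
  rw [this]
  apply Finset.prod_le_prod
  · intros; positivity
  · intro i _
    have := hM.eigenvalues_pos i
    simp
    linarith

lemma aux_eig {n : ℕ} {A : Matrix (Fin n) (Fin n) ℝ} (hA : A.IsSymm) :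
    ∃ d : Fin n → ℝ, IsEigVec A d ∧ ∀ i, |d i| ≤ frobNorm A := by
  have hH : A.IsHermitian := by
    rw [Matrix.IsHermitian, Matrix.conjTranspose_eq_transpose_of_trivial]; exact hA
  have hsp := hH.spectral_theorem
  rw [Unitary.conjStarAlgAut_apply] at hsp
  have hU : star (hH.eigenvectorUnitary : Matrix (Fin n) (Fin n) ℝ) *
      (hH.eigenvectorUnitary : Matrix (Fin n) (Fin n) ℝ) = 1 := Unitary.coe_star_mul_self _
  generalize (hH.eigenvectorUnitary : Matrix (Fin n) (Fin n) ℝ) = U at hsp hU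
  rw [Matrix.star_eq_conjTranspose, Matrix.conjTranspose_eq_transpose_of_trivial] at hsp hU
  have hd : (RCLike.ofReal ∘ hH.eigenvalues : Fin n → ℝ) = hH.eigenvalues := by
    ext i; simp
  rw [hd] at hsp
  generalize hH.eigenvalues = d at hsp
  refine ⟨d, ⟨U, hU, hsp⟩, fun i => ?_⟩
  have hf : frobSq A = ∑ i, d i ^ 2 := by
    have h1 : frobSq A = (A * Aᵀ).trace := by
      simp [frobSq, Matrix.trace, Matrix.mul_apply, sq]
    have h2 : A * Aᵀ = U * (diagonal d * diagonal d * Uᵀ) := by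
      rw [hA.eq]
      conv_lhs => rw [hsp]
      calc U * diagonal d * Uᵀ * (U * diagonal d * Uᵀ)
          = U * diagonal d * (Uᵀ * U) * diagonal d * Uᵀ := by simp only [Matrix.mul_assoc]
        _ = _ := by rw [hU]; simp only [Matrix.mul_assoc, Matrix.mul_one]
    rw [h1, h2, Matrix.trace_mul_comm, Matrix.mul_assoc, hU, Matrix.mul_one,
      Matrix.diagonal_mul_diagonal, Matrix.trace_diagonal]
    simp [sq]
  rw [frobNorm, hf]
  apply Real.abs_le_sqrt
  exact Finset.single_le_sum (f := fun i => d i ^ 2) (fun j _ => sq_nonneg _) (Finset.mem_univ i)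

lemma aux_lsc {X : Type*} [TopologicalSpace X] {φ : X → EReal} (h : LowerSemicontinuous φ)
    (hb : ∀ x, φ x ≠ ⊥) {K : Set X} (hK : IsCompact K) :
    ∃ m : ℝ, ∀ x ∈ K, (m : EReal) ≤ φ x := by
  rcases K.eq_empty_or_nonempty with rfl | hne
  · exact ⟨0, by simp⟩
  · obtain ⟨a, ha, hmin⟩ := (h.lowerSemicontinuousOn K).exists_isMinOn hne hK
    obtain ⟨m, hm⟩ : ∃ m : ℝ, (m : EReal) ≤ φ a := by
      obtain ⟨m, hm⟩ := EReal.lt_iff_exists_real_btwn.1 (bot_lt_iff_ne_bot.2 (hb a))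
      exact ⟨m, hm.2.le⟩
    exact ⟨m, fun x hx => hm.trans (hmin hx)⟩

lemma aux_entry {n : ℕ} (A : Matrix (Fin n) (Fin n) ℝ) (i j : Fin n) :
    |A i j| ≤ frobNorm A := by
  apply Real.abs_le_sqrt
  calc A i j ^ 2 ≤ ∑ j, A i j ^ 2 :=
        Finset.single_le_sum (f := fun j => A i j ^ 2) (fun j _ => sq_nonneg _) (Finset.mem_univ j)
    _ ≤ _ := Finset.single_le_sum (f := fun i => ∑ j, A i j ^ 2)
        (fun i _ => Finset.sum_nonneg fun j _ => sq_nonneg _) (Finset.mem_univ i)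

lemma aux_box (n : ℕ) (R : ℝ) :
    IsCompact {A : Matrix (Fin n) (Fin n) ℝ | ∀ i j, A i j ∈ Set.Icc (-R) R} := by
  have : {A : Matrix (Fin n) (Fin n) ℝ | ∀ i j, A i j ∈ Set.Icc (-R) R} =
    Set.pi Set.univ (fun _ : Fin n => Set.pi Set.univ (fun _ : Fin n => Set.Icc (-R) R)) := by
    exact Set.ext fun A => ⟨fun h i _ j _ => h i j, fun h i j => h i trivial j trivial⟩
  rw [this]
  exact isCompact_univ_pi fun _ => isCompact_univ_pi fun _ => isCompact_Icc

/-- first part of Theorem 3 of the paper. For the MM iterates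
`C⁽ˡ⁺¹⁾ ∈ Argmin f(·) + tr(∇T_S(C⁽ˡ⁾)·) + g₀ + g₁` over symmetric matrices, the values
`F(C⁽ˡ⁾)` of `F = f + T_S + g₀ + g₁` form a nonincreasing sequence converging to a real number,
and the sequence `(C⁽ˡ⁾)` has a cluster point. -/
theorem stmt16 (n : ℕ) (hn : 0 < n) (σ : ℝ) (hσ : 0 < σ)
    (S : Matrix (Fin n) (Fin n) ℝ) (hS : S.PosSemidef)
    (g₀ g₁ : Matrix (Fin n) (Fin n) ℝ → EReal) (ψ : (Fin n → ℝ) → EReal)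
    (hψ : Gamma0 ψ) (hg₀ : IsSpectral g₀ ψ) (hg₁ : Gamma0 g₁)
    (hdom : ∃ C : Matrix (Fin n) (Fin n) ℝ, logdetF σ C ≠ ⊤ ∧ g₀ C ≠ ⊤ ∧ g₁ C ≠ ⊤)
    (hcoer : ∀ M : ℝ, ∃ R : ℝ, ∀ C : Matrix (Fin n) (Fin n) ℝ, C.IsSymm →
      R ≤ frobNorm C → (M : EReal) ≤ logdetF σ C + g₀ C + g₁ C)
    (C : ℕ → Matrix (Fin n) (Fin n) ℝ)
    (hC0 : (C 0).PosDef)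
    (hE : {A : Matrix (Fin n) (Fin n) ℝ | A.IsSymm ∧
        logdetF σ A + traceTS σ S A + g₀ A + g₁ A
          ≤ logdetF σ (C 0) + traceTS σ S (C 0) + g₀ (C 0) + g₁ (C 0)}
      ⊆ intrinsicInterior ℝ
          ({A : Matrix (Fin n) (Fin n) ℝ | g₀ A ≠ ⊤} ∩ {A | g₁ A ≠ ⊤}))
    (hiter : ∀ l : ℕ, (C (l + 1)).IsSymm ∧
      ∀ A : Matrix (Fin n) (Fin n) ℝ, A.IsSymm →
        logdetF σ (C (l + 1)) + (((gradTS σ S (C l) * C (l + 1)).trace : ℝ) : EReal)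
            + g₀ (C (l + 1)) + g₁ (C (l + 1))
          ≤ logdetF σ A + (((gradTS σ S (C l) * A).trace : ℝ) : EReal) + g₀ A + g₁ A) :
    (Antitone (fun l => logdetF σ (C l) + traceTS σ S (C l) + g₀ (C l) + g₁ (C l)) ∧
      ∃ Fhat : ℝ, Filter.Tendsto
        (fun l => logdetF σ (C l) + traceTS σ S (C l) + g₀ (C l) + g₁ (C l))
        Filter.atTop (nhds (Fhat : EReal))) ∧
    ∃ Chat : Matrix (Fin n) (Fin n) ℝ, MapClusterPt Chat Filter.atTop C := by
  have symm_of : ∀ {A : Matrix (Fin n) (Fin n) ℝ}, A.PosDef → A.IsSymm := by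
    intro A hA
    have := hA.isHermitian
    rwa [Matrix.IsHermitian, Matrix.conjTranspose_eq_transpose_of_trivial] at this
  have g0bot : ∀ A : Matrix (Fin n) (Fin n) ℝ, A.IsSymm → g₀ A ≠ ⊥ := by
    intro A hA
    obtain ⟨d, hd, -⟩ := aux_eig hA
    rw [hg₀.2 A d hd]
    exact hψ.1.2 d
  have hg1bot := hg₁.1.2
  -- finiteness along the sequence
  have hstep : ∀ l, ((C l).PosDef ∧ g₀ (C l) ≠ ⊤ ∧ g₁ (C l) ≠ ⊤) →
      ((C (l+1)).PosDef ∧ g₀ (C (l+1)) ≠ ⊤ ∧ g₁ (C (l+1)) ≠ ⊤) ∧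
      logdetF σ (C (l+1)) + traceTS σ S (C (l+1)) + g₀ (C (l+1)) + g₁ (C (l+1)) ≤
      logdetF σ (C l) + traceTS σ S (C l) + g₀ (C l) + g₁ (C l) := by
    rintro l ⟨hP, h0, h1⟩
    obtain ⟨hs, hmin⟩ := hiter l
    have hm := hmin (C l) (symm_of hP)
    have b0 := g0bot _ (symm_of hP)
    have b1 := hg1bot (C l)
    have b0' := g0bot _ hs
    have b1' := hg1bot (C (l+1))
    have e1 : logdetF σ (C l) = ((Real.log ((C l)⁻¹ + σ ^ 2 • (1 : Matrix (Fin n) (Fin n) ℝ)).det : ℝ) : EReal) := if_pos hP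
    have e2 : traceTS σ S (C l) = ((((1 + σ ^ 2 • (C l))⁻¹ * (C l) * S).trace : ℝ) : EReal) :=
      if_pos hP.posSemidef
    rw [e1, e2]
    rw [e1] at hm
    generalize g₀ (C l) = x at *
    generalize g₁ (C l) = y at *
    lift x to ℝ using ⟨h0, b0⟩
    lift y to ℝ using ⟨h1, b1⟩
    by_cases hP' : (C (l+1)).PosDef
    swap
    · have e1' : logdetF σ (C (l+1)) = ⊤ := if_neg hP'
      rw [e1', EReal.top_add_coe, EReal.top_add_of_ne_bot b0', EReal.top_add_of_ne_bot b1'] at hm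
      exfalso
      have := top_le_iff.1 hm
      norm_cast at this
    have e1' : logdetF σ (C (l+1)) = ((Real.log ((C (l+1))⁻¹ + σ ^ 2 • (1 : Matrix (Fin n) (Fin n) ℝ)).det : ℝ) : EReal) := if_pos hP'
    have e2' : traceTS σ S (C (l+1)) = ((((1 + σ ^ 2 • (C (l+1)))⁻¹ * (C (l+1)) * S).trace : ℝ) : EReal) :=
      if_pos hP'.posSemidef
    rw [e1', e2']
    rw [e1'] at hm
    have hc := aux_T_concave hσ hS hP.posSemidef hP'.posSemidef
    by_cases h0' : g₀ (C (l+1)) = ⊤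
    · rw [h0', ← EReal.coe_add, EReal.coe_add_top, EReal.top_add_of_ne_bot b1'] at hm
      exfalso
      have := top_le_iff.1 hm
      norm_cast at this
    by_cases h1' : g₁ (C (l+1)) = ⊤
    · rw [h1'] at hm
      generalize g₀ (C (l+1)) = x' at *
      lift x' to ℝ using ⟨h0', b0'⟩
      rw [← EReal.coe_add, ← EReal.coe_add, EReal.coe_add_top] at hm
      exfalso
      have := top_le_iff.1 hm
      norm_cast at this
    refine ⟨⟨hP', h0', h1'⟩, ?_⟩
    generalize g₀ (C (l+1)) = x' at *
    generalize g₁ (C (l+1)) = y' at *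
    lift x' to ℝ using ⟨h0', b0'⟩
    lift y' to ℝ using ⟨h1', b1'⟩
    norm_cast at hm ⊢
    linarith
  have hinit : (C 0).PosDef ∧ g₀ (C 0) ≠ ⊤ ∧ g₁ (C 0) ≠ ⊤ :=
by
    have hmem := hE ⟨symm_of hC0, le_rfl⟩
    have hmem2 := intrinsicInterior_subset hmem
    exact ⟨hC0, hmem2.1, hmem2.2⟩
  have hfin : ∀ l, (C l).PosDef ∧ g₀ (C l) ≠ ⊤ ∧ g₁ (C l) ≠ ⊤ := by
    intro l
    induction l with
    | zero => exact hinit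
    | succ k ih => exact (hstep k ih).1
  have hanti : Antitone (fun l => logdetF σ (C l) + traceTS σ S (C l) + g₀ (C l) + g₁ (C l)) :=
    antitone_nat_of_succ_le fun l => (hstep l (hfin l)).2
  have hreal : ∀ l, ∃ f t x y : ℝ, logdetF σ (C l) = f ∧ traceTS σ S (C l) = t ∧
      g₀ (C l) = x ∧ g₁ (C l) = y ∧ 0 ≤ t ∧ Real.log ((σ ^ 2) ^ n) ≤ f := by
    intro l
    obtain ⟨hP, h0, h1⟩ := hfin l
    refine ⟨_, _, (g₀ (C l)).toReal, (g₁ (C l)).toReal, if_pos hP, if_pos hP.posSemidef,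
      (EReal.coe_toReal h0 (g0bot _ (symm_of hP))).symm, (EReal.coe_toReal h1 (hg1bot _)).symm,
      aux_T_nonneg hS hP.posSemidef, aux_logdet hσ hP⟩
  obtain ⟨f0, t0, x0, y0, hf0, ht0, hx0, hy0, -, -⟩ := hreal 0
  have hF0 : logdetF σ (C 0) + traceTS σ S (C 0) + g₀ (C 0) + g₁ (C 0) =
      ((f0 + t0 + x0 + y0 : ℝ) : EReal) := by
    rw [hf0, ht0, hx0, hy0]; norm_cast
  obtain ⟨R, hR⟩ := hcoer (f0 + t0 + x0 + y0 + 1)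
  have hbd : ∀ l, frobNorm (C l) ≤ R := by
    intro l
    by_contra! hlt
    have h1 := hR (C l) (symm_of (hfin l).1) hlt.le
    have h2 : _ ≤ _ := hanti (Nat.zero_le l)
    simp only [] at h2
    rw [hF0] at h2
    obtain ⟨f, t, x, y, hf, ht, hx, hy, htp, -⟩ := hreal l
    rw [hf, ht, hx, hy] at h2
    rw [hf, hx, hy] at h1
    norm_cast at h1 h2
    linarith
  have hbox : ∀ l, C l ∈ {A : Matrix (Fin n) (Fin n) ℝ | ∀ i j, A i j ∈ Set.Icc (-R) R} :=
    fun l i j => abs_le.1 ((aux_entry (C l) i j).trans (hbd l))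
  obtain ⟨m1, hm1⟩ := aux_lsc hg₁.2.1 hg1bot (aux_box n R)
  obtain ⟨m0, hm0⟩ := aux_lsc hψ.2.1 hψ.1.2
    (isCompact_univ_pi fun _ : Fin n => isCompact_Icc (a := -R) (b := R))
  refine ⟨⟨hanti, ?_⟩, ?_⟩
  · have hlim := tendsto_atTop_iInf hanti
    set L := ⨅ l, (logdetF σ (C l) + traceTS σ S (C l) + g₀ (C l) + g₁ (C l)) with hL
    have hLtop : L ≠ ⊤ := by
      have : L ≤ ((f0 + t0 + x0 + y0 : ℝ) : EReal) := hF0 ▸ iInf_le _ 0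
      exact (this.trans_lt (EReal.coe_lt_top _)).ne
    have hLbot : L ≠ ⊥ := by
      have : ((Real.log ((σ ^ 2) ^ n) + 0 + m0 + m1 : ℝ) : EReal) ≤ L := by
        refine le_iInf fun l => ?_
        have h1 := hm1 _ (hbox l)
        obtain ⟨d, hd, hdb⟩ := aux_eig (symm_of (hfin l).1)
        have h0 := hm0 d (fun i _ => abs_le.1 ((hdb i).trans (hbd l)))
        rw [← hg₀.2 _ d hd] at h0
        obtain ⟨f, t, x, y, hf, ht, hx, hy, htp, hfp⟩ := hreal l
        rw [hf, ht, hx, hy]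
        rw [hx] at h0
        rw [hy] at h1
        norm_cast at h0 h1 ⊢
        linarith
      exact ((EReal.bot_lt_coe _).trans_le this).ne'
    refine ⟨L.toReal, ?_⟩
    rw [EReal.coe_toReal hLtop hLbot]
    exact hlim
  · obtain ⟨Chat, -, h⟩ := (aux_box n R).exists_mapClusterPt (f := atTop) (u := C)
      (tendsto_principal.2 (Eventually.of_forall hbox))
    exact ⟨Chat, h⟩
end
end

section
/- Let n be a positive integer, σ > 0, and let S be a real symmetric positive semidefinite n×n matrix. Define f : S_n → (−∞,+∞] by f(C) = log det(C⁻¹ + σ²I) if C is positive definite and +∞ otherwise; define T_S : S_n → (−∞,+∞] by T_S(C) = tr((I + σ²C)⁻¹ C S) if C is positive semidefinite and +∞ otherwise; for positive semidefinite C set ∇T_S(C) = (I + σ²C)⁻¹ S (I + σ²C)⁻¹. Let g₀ be the spectral function on S_n associated with some ψ ∈ Γ0(ℝⁿ) invariant under permutations of coordinates, let g₁ ∈ Γ0(S_n), and set F = f + T_S + g₀ + g₁. Assume dom f ∩ dom g₀ ∩ dom g₁ ≠ ∅, f + g₀ + g₁ is coercive, and that the sublevel set E = {C ∈ S_n : F(C)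 ≤ F(C⁽⁰⁾)} is contained in the relative interior of dom g₀ ∩ dom g₁. Let C⁽⁰⁾ ∈ S_n be positive definite and let (C⁽ˡ⁾)_{l≥0} be any sequence such that for every l ≥ 0, C⁽ˡ⁺¹⁾ is a minimizer over S_n of C ↦ f(C) + tr(∇T_S(C⁽ˡ⁾) C) + g₀(C) + g₁(C), and let F̂ = lim_{l→∞} F(C⁽ˡ⁾). Then every cluster point Ĉ of (C⁽ˡ⁾)_{l≥0} is positive definite, satisfies F(Ĉ) = F̂, and is a critical point of F in the sense that the matrix (Ĉ + σ²Ĉ²)⁻¹ − (I + σ²Ĉ)⁻¹ S (I + σ²Ĉ)⁻¹ is a subgradient of g₀ + g₁ at Ĉ, i.e., for every C ∈ S_n, g₀(C) + g₁(C) ≥ g₀(Ĉ) + g₁(Ĉ) + tr(((Ĉ + σ²Ĉ²)⁻¹ − (I + σ²Ĉ)⁻¹ S (I + σ²Ĉ)⁻¹)(C − Ĉ)). -/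
open Matrix Filter Topology Set

noncomputable section

open scoped Classical

abbrev MM (n : ℕ) := Matrix (Fin n) (Fin n) ℝ

lemma exists_eig {n : ℕ} (A : MM n) (hA : A.IsSymm) :
    ∃ U : MM n, ∃ d, IsOrth U ∧ A = U * Matrix.diagonal d * Uᵀ := by
  have hH : A.IsHermitian := by
    rw [Matrix.IsHermitian, Matrix.conjTranspose_eq_transpose_of_trivial]; exact hA
  refine ⟨(hH.eigenvectorUnitary : MM n), hH.eigenvalues, ?_, ?_⟩
  · have := Unitary.coe_star_mul_self hH.eigenvectorUnitary
    rw [IsOrth, ← Matrix.conjTranspose_eq_transpose_of_trivial]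
    exact this
  · conv_lhs => rw [hH.spectral_theorem]
    rw [Unitary.conjStarAlgAut_apply, ← Matrix.conjTranspose_eq_transpose_of_trivial]
    rfl

lemma schur_le {n : ℕ} (ψ : (Fin n → ℝ) → EReal) (hψ : Gamma0 ψ) (hp : PermInv ψ)
    (W : MM n) (hW : IsOrth W) (d : Fin n → ℝ) :
    ψ (fun i => (W * Matrix.diagonal d * Wᵀ) i i) ≤ ψ d := by
  have hW' : W * Wᵀ = 1 := mul_eq_one_comm.mp hW
  set M : MM n := Matrix.of fun i j => W i j ^ 2 with hM
  have hMd : (fun i => (W * Matrix.diagonal d * Wᵀ) i i) = M *ᵥ d := by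
    funext i
    rw [Matrix.mul_apply]
    simp only [Matrix.mul_diagonal, Matrix.transpose_apply, Matrix.mulVec,
      dotProduct, hM, Matrix.of_apply]
    exact Finset.sum_congr rfl fun j _ => by ring
  have hds : M ∈ doublyStochastic ℝ (Fin n) := by
    rw [mem_doublyStochastic_iff_sum]
    refine ⟨fun i j => by simp only [hM, Matrix.of_apply]; positivity, fun i => ?_, fun j => ?_⟩
    · have := congrFun (congrFun hW' i) i
      simp only [Matrix.mul_apply, Matrix.transpose_apply, Matrix.one_apply_eq] at this
      rw [← this]
      exact Finset.sum_congr rfl fun j _ => by simp only [hM, Matrix.of_apply]; ring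
    · have := congrFun (congrFun hW j) j
      simp only [Matrix.mul_apply, Matrix.transpose_apply, Matrix.one_apply_eq] at this
      rw [← this]
      exact Finset.sum_congr rfl fun j _ => by simp only [hM, Matrix.of_apply]; ring
  rw [hMd]
  by_cases htop : ψ d = ⊤
  · rw [htop]; exact le_top
  obtain ⟨r, hr⟩ : ∃ r : ℝ, ψ d = r := ⟨(ψ d).toReal, (EReal.coe_toReal htop (hψ.1.2 d)).symm⟩
  have hconv : Convex ℝ {N : MM n | ψ (N *ᵥ d) ≤ ψ d} := by
    intro x hx y hy a b ha hb hab
    simp only [Set.mem_ofPred_eq] at hx hy ⊢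
    rw [Matrix.add_mulVec, Matrix.smul_mulVec, Matrix.smul_mulVec]
    refine (hψ.2.2 _ _ a b ha hb hab).trans ?_
    have ha' : (0 : EReal) ≤ a := by exact_mod_cast ha
    have hb' : (0 : EReal) ≤ b := by exact_mod_cast hb
    refine (add_le_add (mul_le_mul_of_nonneg_left hx ha') (mul_le_mul_of_nonneg_left hy hb')).trans ?_
    rw [hr]
    have : a * r + b * r = r := by rw [← add_mul, hab, one_mul]
    exact_mod_cast this.le
  have hsub := convexHull_min (s := {x | ∃ σ : Equiv.Perm (Fin n), σ.permMatrix ℝ = x})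
    (t := {N : MM n | ψ (N *ᵥ d) ≤ ψ d}) (by
      rintro _ ⟨τ, rfl⟩
      simp only [Set.mem_ofPred_eq]
      rw [Matrix.permMatrix_mulVec, hp]) hconv
  apply hsub
  have h2 : M ∈ (doublyStochastic ℝ (Fin n) : Set (MM n)) := hds
  rw [doublyStochastic_eq_convexHull_permMatrix] at h2
  exact h2

def GG {n : ℕ} (ψ : (Fin n → ℝ) → EReal) (A : MM n) : EReal :=
  ⨆ U : {U : MM n // IsOrth U}, ψ (fun i => (U.1ᵀ * A * U.1) i i)

lemma GG_eq {n : ℕ} (g : MM n → EReal) (ψ : (Fin n → ℝ) → EReal) (hψ : Gamma0 ψ)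
    (hg : IsSpectral g ψ) (A : MM n) (hA : A.IsSymm) : g A = GG ψ A := by
  obtain ⟨U, d, hU, hAU⟩ := exists_eig A hA
  rw [hg.2 A d ⟨U, hU, hAU⟩]
  apply le_antisymm
  · refine le_trans ?_ (le_iSup _ (⟨U, hU⟩ : {U : MM n // IsOrth U}))
    have : (fun i => (Uᵀ * A * U) i i) = d := by
      have : Uᵀ * A * U = Matrix.diagonal d := by
        rw [hAU]
        calc _ = (Uᵀ * U) * Matrix.diagonal d * (Uᵀ * U) := by simp only [Matrix.mul_assoc]
          _ = _ := by rw [hU]; simp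
      rw [this]; simp
    simp only [this]; exact le_rfl
  · refine iSup_le fun V => ?_
    have hV : V.1 * V.1ᵀ = 1 := mul_eq_one_comm.mp V.2
    have hW : IsOrth (V.1ᵀ * U) := by
      unfold IsOrth at *
      calc _ = Uᵀ * (V.1 * V.1ᵀ) * U := by simp [Matrix.mul_assoc]
        _ = _ := by rw [hV]; simpa using hU
    have := schur_le ψ hψ hg.1 _ hW d
    have e : V.1ᵀ * U * Matrix.diagonal d * (V.1ᵀ * U)ᵀ = V.1ᵀ * A * V.1 := by
      rw [hAU]; simp [Matrix.mul_assoc]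
    rwa [e] at this

lemma GG_lsc {n : ℕ} (ψ : (Fin n → ℝ) → EReal) (hψ : Gamma0 ψ) :
    LowerSemicontinuous (GG ψ) := by
  apply lowerSemicontinuous_iSup
  intro U
  refine LowerSemicontinuous.comp hψ.2.1 ?_
  fun_prop

lemma GG_ne_bot {n : ℕ} (ψ : (Fin n → ℝ) → EReal) (hψ : Gamma0 ψ) (A : MM n) : GG ψ A ≠ ⊥ := by
  have h1 : IsOrth (1 : MM n) := by simp [IsOrth]
  have := le_iSup (fun U : {U : MM n // IsOrth U} => ψ (fun i => (U.1ᵀ * A * U.1) i i)) ⟨1, h1⟩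
  intro h
  rw [GG] at h
  rw [h] at this
  exact hψ.1.2 _ (le_bot_iff.mp this)

lemma GG_conv {n : ℕ} (ψ : (Fin n → ℝ) → EReal) (hψ : Gamma0 ψ) : EConvex (GG ψ) := by
  intro x y a b ha hb hab
  refine iSup_le fun U => ?_
  have ha' : (0 : EReal) ≤ a := by exact_mod_cast ha
  have hb' : (0 : EReal) ≤ b := by exact_mod_cast hb
  have e : (fun i => (U.1ᵀ * (a • x + b • y) * U.1) i i) =
      a • (fun i => (U.1ᵀ * x * U.1) i i) + b • (fun i => (U.1ᵀ * y * U.1) i i) := by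
    funext i
    simp [Matrix.mul_add, Matrix.add_mul]
  rw [e]
  refine (hψ.2.2 _ _ a b ha hb hab).trans ?_
  exact add_le_add
    (mul_le_mul_of_nonneg_left (le_iSup (fun U : {U : MM n // IsOrth U} =>
      ψ (fun i => (U.1ᵀ * x * U.1) i i)) U) ha')
    (mul_le_mul_of_nonneg_left (le_iSup (fun U : {U : MM n // IsOrth U} =>
      ψ (fun i => (U.1ᵀ * y * U.1) i i)) U) hb')

lemma pd_symm {n : ℕ} {A : MM n} (h : A.PosDef) : A.IsSymm := by
  have := h.1
  rwa [Matrix.IsHermitian, Matrix.conjTranspose_eq_transpose_of_trivial] at this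

lemma symm_herm {n : ℕ} {A : MM n} (h : A.IsSymm) : A.IsHermitian := by
  rw [Matrix.IsHermitian, Matrix.conjTranspose_eq_transpose_of_trivial]; exact h

lemma eig_shift {n : ℕ} {A U : MM n} {d : Fin n → ℝ} (hU : IsOrth U)
    (h : A = U * Matrix.diagonal d * Uᵀ) (m : ℝ) :
    A + m • (1 : MM n) = U * Matrix.diagonal (fun i => d i + m) * Uᵀ := by
  have hU' : U * Uᵀ = 1 := mul_eq_one_comm.mp hU
  have : Matrix.diagonal (fun i => d i + m) = Matrix.diagonal d + m • (1 : MM n) := by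
    rw [← Matrix.diagonal_one, ← Matrix.diagonal_smul, Matrix.diagonal_add]
    congr 1; funext i; simp
  rw [this, Matrix.mul_add, Matrix.add_mul, ← h]
  simp [hU']

lemma psd_conj {n : ℕ} {U : MM n} {d : Fin n → ℝ} (hd : ∀ i, 0 ≤ d i) :
    (U * Matrix.diagonal d * Uᵀ).PosSemidef := by
  have := (Matrix.PosSemidef.diagonal (n := Fin n) (R := ℝ) (d := d) hd).mul_mul_conjTranspose_same U
  rwa [Matrix.conjTranspose_eq_transpose_of_trivial] at this

lemma pd_line {n : ℕ} {A D : MM n} (hA : A.PosDef) (hD : D.IsSymm) :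
    ∃ δ > 0, ∀ t : ℝ, 0 ≤ t → t < δ → (A + t • D).PosDef := by
  obtain ⟨U, d, hU, hAU⟩ := exists_eig A (pd_symm hA)
  obtain ⟨V, e, hV, hDV⟩ := exists_eig D hD
  have hdp : ∀ i, 0 < d i := by
    have h1 := hA
    have h2 : (Uᵀ * A * U) = Matrix.diagonal d := by
      rw [hAU]
      calc _ = (Uᵀ * U) * Matrix.diagonal d * (Uᵀ * U) := by simp only [Matrix.mul_assoc]
        _ = _ := by rw [hU]; simp
    have h3 : (Matrix.diagonal d).PosDef := by
      rw [← h2]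
      have hinj : Function.Injective U.mulVec := by
        intro x y hxy
        have := congrArg (Uᵀ.mulVec) hxy
        simp only [Matrix.mulVec_mulVec] at this
        rw [hU] at this
        simpa using this
      have := h1.conjTranspose_mul_mul_same hinj
      rwa [Matrix.conjTranspose_eq_transpose_of_trivial] at this
    exact Matrix.posDef_diagonal_iff.mp h3
  obtain ⟨ε, hε, hεd⟩ : ∃ ε > 0, ∀ i, ε ≤ d i := by
    rcases isEmpty_or_nonempty (Fin n) with h | h
    · exact ⟨1, one_pos, fun i => (h.false i).elim⟩
    · obtain ⟨i, hi⟩ := Finite.exists_min d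
      exact ⟨d i, hdp i, hi⟩
  set m : ℝ := 1 + ∑ i, |e i| with hm
  have hm0 : 0 < m := by positivity
  have hme : ∀ i, 0 ≤ e i + m := fun i => by
    have := Finset.single_le_sum (f := fun i => |e i|) (fun i _ => abs_nonneg _) (Finset.mem_univ i)
    have h2 := neg_abs_le (e i)
    linarith
  refine ⟨ε / m, by positivity, fun t ht htd => ?_⟩
  rw [lt_div_iff₀ hm0] at htd
  have p1 : (A + (-ε) • (1 : MM n)).PosSemidef := by
    rw [eig_shift hU hAU]; exact psd_conj fun i => by linarith [hεd i]
  have p2 : (D + m • (1 : MM n)).PosSemidef := by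
    rw [eig_shift hV hDV]; exact psd_conj hme
  have p3 : ((ε - t * m) • (1 : MM n)).PosDef := Matrix.PosDef.one.smul (by linarith)
  have := p3.add_posSemidef (p1.add (p2.smul ht))
  convert this using 1
  rw [smul_add, smul_smul, sub_smul, neg_smul]
  abel

lemma tr_nonneg {n : ℕ} {A B : MM n} (hA : A.PosSemidef) (hB : B.PosSemidef) :
    0 ≤ (A * B).trace := by
  obtain ⟨U, d, hU, hAU⟩ := exists_eig A (by
    have := hA.1
    rwa [Matrix.IsHermitian, Matrix.conjTranspose_eq_transpose_of_trivial] at this)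
  have h2 : (Uᵀ * A * U) = Matrix.diagonal d := by
    rw [hAU]
    calc _ = (Uᵀ * U) * Matrix.diagonal d * (Uᵀ * U) := by simp only [Matrix.mul_assoc]
      _ = _ := by rw [hU]; simp
  have hd : ∀ i, 0 ≤ d i := by
    intro i
    have := (hA.conjTranspose_mul_mul_same U).diag_nonneg (i := i)
    rw [Matrix.conjTranspose_eq_transpose_of_trivial, h2] at this
    simpa using this
  have hQ := hB.conjTranspose_mul_mul_same U
  rw [Matrix.conjTranspose_eq_transpose_of_trivial] at hQ
  have : (A * B).trace = (Matrix.diagonal d * (Uᵀ * B * U)).trace := by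
    rw [hAU]
    calc _ = (U * (Matrix.diagonal d * (Uᵀ * B))).trace := by simp only [Matrix.mul_assoc]
      _ = _ := by rw [Matrix.trace_mul_comm]; simp only [Matrix.mul_assoc]
  rw [this, Matrix.trace]
  refine Finset.sum_nonneg fun i _ => ?_
  rw [Matrix.diag_apply, Matrix.diagonal_mul]
  exact mul_nonneg (hd i) hQ.diag_nonneg

lemma pd_one_add {n : ℕ} {σ : ℝ} {A : MM n} (hA : A.PosSemidef) : (1 + σ ^ 2 • A).PosDef :=
  Matrix.PosDef.one.add_posSemidef (hA.smul (by positivity))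

lemma T_concave {n : ℕ} {σ : ℝ} (hσ : 0 < σ) {S A B : MM n} (hS : S.PosSemidef)
    (hA : A.PosSemidef) (hB : B.PosSemidef) :
    ((1 + σ ^ 2 • A)⁻¹ * A * S).trace ≤ ((1 + σ ^ 2 • B)⁻¹ * B * S).trace
      + (gradTS σ S B * (A - B)).trace := by
  have hX := pd_one_add (σ := σ) hA
  have hY := pd_one_add (σ := σ) hB
  unfold gradTS
  set X := 1 + σ ^ 2 • A with hXd
  set Y := 1 + σ ^ 2 • B with hYd
  have hs : σ ^ 2 ≠ 0 := by positivity
  have eA : A = (σ ^ 2)⁻¹ • (X - 1) := by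
    rw [hXd, add_sub_cancel_left, smul_smul, inv_mul_cancel₀ hs, one_smul]
  have eB : B = (σ ^ 2)⁻¹ • (Y - 1) := by
    rw [hYd, add_sub_cancel_left, smul_smul, inv_mul_cancel₀ hs, one_smul]
  have uX : X⁻¹ * X = 1 := Matrix.nonsing_inv_mul _ (hX.isUnit.map Matrix.detMonoidHom)
  have uY : Y⁻¹ * Y = 1 := Matrix.nonsing_inv_mul _ (hY.isUnit.map Matrix.detMonoidHom)
  have uX' : X * X⁻¹ = 1 := mul_eq_one_comm.mp uX
  have hP : ((X⁻¹ - Y⁻¹) * X * (X⁻¹ - Y⁻¹)).PosSemidef := by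
    have h := hX.posSemidef.mul_mul_conjTranspose_same (X⁻¹ - Y⁻¹)
    have : (X⁻¹ - Y⁻¹)ᴴ = X⁻¹ - Y⁻¹ := by
      rw [Matrix.conjTranspose_sub, hX.inv.1.eq, hY.inv.1.eq]
    rwa [this] at h
  have hQ := tr_nonneg hP hS
  have e1 : (X⁻¹ - Y⁻¹) * X * (X⁻¹ - Y⁻¹) = X⁻¹ - Y⁻¹ - Y⁻¹ + Y⁻¹ * X * Y⁻¹ := by
    simp only [sub_mul, mul_sub, uX, Matrix.mul_assoc, uX', one_mul, mul_one]
    abel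
  rw [e1] at hQ
  have e2 : (Y⁻¹ * S * Y⁻¹ * (A - B)).trace = (σ ^ 2)⁻¹ * ((Y⁻¹ * X * Y⁻¹ * S).trace - (Y⁻¹ * S).trace) := by
    have : A - B = (σ ^ 2)⁻¹ • (X - Y) := by
      conv_lhs => rw [eA, eB]
      rw [← smul_sub]; congr 1; abel
    rw [this, Matrix.mul_smul, Matrix.trace_smul, smul_eq_mul, mul_sub, Matrix.trace_sub]
    congr 2
    · rw [Matrix.mul_assoc, Matrix.mul_assoc, Matrix.trace_mul_comm, Matrix.mul_assoc,
        Matrix.trace_mul_comm]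
    · rw [Matrix.mul_assoc, uY, Matrix.mul_one]
  have e3 : ((X⁻¹ * A) * S).trace = (σ ^ 2)⁻¹ * (S.trace - (X⁻¹ * S).trace) := by
    conv_lhs => rw [eA]
    rw [Matrix.mul_smul, mul_sub, uX, Matrix.smul_mul, Matrix.trace_smul, smul_eq_mul, sub_mul,
      mul_one, one_mul, Matrix.trace_sub]
  have e4 : ((Y⁻¹ * B) * S).trace = (σ ^ 2)⁻¹ * (S.trace - (Y⁻¹ * S).trace) := by
    conv_lhs => rw [eB]
    rw [Matrix.mul_smul, mul_sub, uY, Matrix.smul_mul, Matrix.trace_smul, smul_eq_mul, sub_mul,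
      mul_one, one_mul, Matrix.trace_sub]
  rw [e2, e3, e4, ← mul_add]
  apply mul_le_mul_of_nonneg_left _ (by positivity)
  simp only [add_mul, sub_mul, Matrix.trace_add, Matrix.trace_sub] at hQ
  linarith

def lf {n : ℕ} (σ : ℝ) (C : MM n) : ℝ := Real.log (C⁻¹ + σ ^ 2 • (1 : MM n)).det

def tT {n : ℕ} (σ : ℝ) (S C : MM n) : ℝ := ((1 + σ ^ 2 • C)⁻¹ * C * S).trace

lemma pd_inv_mul {n : ℕ} {A : MM n} (h : A.PosDef) : A⁻¹ * A = 1 :=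
  Matrix.nonsing_inv_mul _ (h.isUnit.map Matrix.detMonoidHom)

lemma lf_eq {n : ℕ} {σ : ℝ} {C : MM n} (h : C.PosDef) :
    lf σ C = Real.log (1 + σ ^ 2 • C).det - Real.log C.det := by
  have h1 : (1 + σ ^ 2 • C).det = (C⁻¹ + σ ^ 2 • (1 : MM n)).det * C.det := by
    rw [← Matrix.det_mul, add_mul, pd_inv_mul h, Matrix.smul_mul, one_mul]
  have hp := (pd_one_add (σ := σ) h.posSemidef).det_pos
  rw [h1] at hp
  have hne : (C⁻¹ + σ ^ 2 • (1 : MM n)).det ≠ 0 := fun h0 => by simp [h0] at hp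
  rw [h1, Real.log_mul hne h.det_pos.ne', lf]
  ring

lemma logdet_line {n : ℕ} {X : MM n} (hX : X.PosDef) (D : MM n) :
    HasDerivAt (fun t : ℝ => Real.log (X + t • D).det) (X⁻¹ * D).trace 0 := by
  have e : ∀ t : ℝ, (X + t • D).det = X.det * (1 + t • (X⁻¹ * D)).det := by
    intro t
    rw [← Matrix.det_mul, mul_add, mul_one, Matrix.mul_smul, ← Matrix.mul_assoc,
      mul_eq_one_comm.mp (pd_inv_mul hX), one_mul]
  have h1 : HasDerivAt (fun t : ℝ => (X + t • D).det) (X.det * (X⁻¹ * D).trace) 0 := by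
    simp only [e]
    apply HasDerivAt.const_mul
    rw [show (fun t : ℝ => (1 + t • (X⁻¹ * D)).det) = _ from
      funext fun t => Matrix.det_one_add_smul t (X⁻¹ * D)]
    set P := ((1 + (Polynomial.X : Polynomial ℝ) • (X⁻¹ * D).map Polynomial.C).det).divX.divX
    have h2 := (((hasDerivAt_id (0 : ℝ)).const_mul (X⁻¹ * D).trace).const_add 1).add
      ((P.hasDerivAt 0).mul ((hasDerivAt_id (0 : ℝ)).pow 2))
    refine h2.congr_deriv ?_
    simp
  have h3 := h1.log (by simpa using hX.det_pos.ne')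
  refine h3.congr_deriv ?_
  have := hX.det_pos.ne'
  simp only [zero_smul, add_zero]
  field_simp

lemma lf_line {n : ℕ} {σ : ℝ} {A : MM n} (hA : A.PosDef) (D : MM n) :
    HasDerivAt (fun t : ℝ => Real.log (1 + σ ^ 2 • (A + t • D)).det - Real.log (A + t • D).det)
      (- ((A + σ ^ 2 • (A * A))⁻¹ * D).trace) 0 := by
  have hX := pd_one_add (σ := σ) hA.posSemidef
  have h := (logdet_line hX (σ ^ 2 • D)).sub (logdet_line hA D)
  have hfun : (fun t : ℝ => Real.log (1 + σ ^ 2 • (A + t • D)).det - Real.log (A + t • D).det)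
      = (fun t => Real.log (1 + σ ^ 2 • A + t • σ ^ 2 • D).det)
        - fun t => Real.log (A + t • D).det := by
    funext t
    simp only [Pi.sub_apply]
    congr 3
    rw [smul_add, ← add_assoc, smul_comm]
  rw [hfun]
  refine h.congr_deriv ?_
  symm
  · set X := 1 + σ ^ 2 • A with hXd
    have e1 : A + σ ^ 2 • (A * A) = A * X := by
      rw [hXd, mul_add, mul_one, Matrix.mul_smul]
    have e2 : X⁻¹ * A⁻¹ = A⁻¹ - σ ^ 2 • X⁻¹ := by
      have h1 : X⁻¹ * (X * A⁻¹) = A⁻¹ := by rw [← Matrix.mul_assoc, pd_inv_mul hX, one_mul]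
      have h2 : X * A⁻¹ = A⁻¹ + σ ^ 2 • (1 : MM n) := by
        rw [hXd, add_mul, one_mul, Matrix.smul_mul, mul_eq_one_comm.mp (pd_inv_mul hA)]
      rw [h2, mul_add, Matrix.mul_smul, mul_one] at h1
      rw [eq_sub_iff_add_eq]; exact h1
    rw [e1, Matrix.mul_inv_rev, e2, sub_mul, Matrix.trace_sub, Matrix.mul_smul, Matrix.smul_mul]
    ring

lemma tendsto_matinv {n : ℕ} {X : MM n} (hX : X.PosDef) {u : ℕ → MM n}
    (hu : Tendsto u atTop (𝓝 X)) : Tendsto (fun k => (u k)⁻¹) atTop (𝓝 X⁻¹) := by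
  have hd : Tendsto (fun k => (u k).det) atTop (𝓝 X.det) :=
    ((continuous_id.matrix_det).tendsto X).comp hu
  have ha : Tendsto (fun k => (u k).adjugate) atTop (𝓝 X.adjugate) :=
    ((continuous_id.matrix_adjugate).tendsto X).comp hu
  simp only [Matrix.inv_def, Ring.inverse_eq_inv']
  exact (hd.inv₀ hX.det_pos.ne').smul ha

lemma tendsto_tr {n : ℕ} {X : MM n} {u : ℕ → MM n} (hu : Tendsto u atTop (𝓝 X)) :
    Tendsto (fun k => (u k).trace) atTop (𝓝 X.trace) :=
  ((continuous_id.matrix_trace).tendsto X).comp hu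

lemma tendsto_det {n : ℕ} {X : MM n} {u : ℕ → MM n} (hu : Tendsto u atTop (𝓝 X)) :
    Tendsto (fun k => (u k).det) atTop (𝓝 X.det) :=
  ((continuous_id.matrix_det).tendsto X).comp hu

lemma tendsto_one_add {n : ℕ} {σ : ℝ} {X : MM n} {u : ℕ → MM n} (hu : Tendsto u atTop (𝓝 X)) :
    Tendsto (fun k => 1 + σ ^ 2 • u k) atTop (𝓝 (1 + σ ^ 2 • X)) :=
  (hu.const_smul (σ ^ 2)).const_add 1

lemma tendsto_tT {n : ℕ} {σ : ℝ} {S X : MM n} (hX : X.PosSemidef) {u : ℕ → MM n}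
    (hu : Tendsto u atTop (𝓝 X)) : Tendsto (fun k => tT σ S (u k)) atTop (𝓝 (tT σ S X)) := by
  have h := tendsto_matinv (pd_one_add (σ := σ) hX) (tendsto_one_add hu)
  exact tendsto_tr ((h.mul hu).mul_const S)

lemma tendsto_gr {n : ℕ} {σ : ℝ} {S X : MM n} (hX : X.PosSemidef) {u : ℕ → MM n}
    (hu : Tendsto u atTop (𝓝 X)) : Tendsto (fun k => gradTS σ S (u k)) atTop
      (𝓝 (gradTS σ S X)) := by
  have h := tendsto_matinv (pd_one_add (σ := σ) hX) (tendsto_one_add hu)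
  exact ((h.mul_const S).mul h)

lemma psd_lim {n : ℕ} {X : MM n} {u : ℕ → MM n} (hu : Tendsto u atTop (𝓝 X))
    (h : ∀ k, (u k).PosSemidef) : X.PosSemidef := by
  rw [Matrix.posSemidef_iff_dotProduct_mulVec]
  constructor
  · have h1 : Tendsto (fun k => (u k)ᴴ) atTop (𝓝 Xᴴ) :=
      ((continuous_id.matrix_conjTranspose).tendsto X).comp hu
    have h2 : (fun k => (u k)ᴴ) = u := funext fun k => (h k).1
    rw [h2] at h1
    exact tendsto_nhds_unique h1 hu
  · intro x
    have hc : Continuous fun Y : MM n => star x ⬝ᵥ (Y *ᵥ x) := by fun_prop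
    exact ge_of_tendsto' ((hc.tendsto X).comp hu) fun k => (h k).dotProduct_mulVec_nonneg x

lemma real_of {x : EReal} (h1 : x ≠ ⊤) (h2 : x ≠ ⊥) : ∃ r : ℝ, x = r :=
  ⟨x.toReal, (EReal.coe_toReal h1 h2).symm⟩

lemma logdetF_pd {n : ℕ} {σ : ℝ} {A : MM n} (h : A.PosDef) : logdetF σ A = (lf σ A : ℝ) := by
  rw [logdetF, if_pos h]; rfl

lemma traceTS_psd {n : ℕ} {σ : ℝ} {S A : MM n} (h : A.PosSemidef) :
    traceTS σ S A = (tT σ S A : ℝ) := by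
  rw [traceTS, if_pos h]; rfl

lemma lsc_le {n : ℕ} {H : MM n → EReal} (hH : LowerSemicontinuous H) {X : MM n} {u : ℕ → MM n}
    (hu : Tendsto u atTop (𝓝 X)) {v : ℕ → ℝ} {r : ℝ} (hv : Tendsto v atTop (𝓝 r))
    (huv : ∀ k, H (u k) = v k) : H X ≤ r := by
  by_contra hlt
  obtain ⟨m, h1, h2⟩ := EReal.lt_iff_exists_real_btwn.mp (not_le.mp hlt)
  have := hu.eventually (hH X m h2)
  have h3 : m ≤ r := ge_of_tendsto hv (this.mono fun k hk => by
    simp only [huv] at hk; exact_mod_cast hk.le)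
  have h1' : r < m := by exact_mod_cast h1
  linarith
/-- second part of Theorem 3 of the paper. With `F = f + T_S + g₀ + g₁` and
`F̂ = lim F(C⁽ˡ⁾)`, every cluster point `Ĉ` of the MM iterates is positive definite, satisfies
`F(Ĉ) = F̂`, and `(Ĉ + σ²Ĉ²)⁻¹ − (I+σ²Ĉ)⁻¹S(I+σ²Ĉ)⁻¹` is a subgradient of `g₀ + g₁` at `Ĉ`. -/
theorem stmt17 (n : ℕ) (hn : 0 < n) (σ : ℝ) (hσ : 0 < σ)
    (S : Matrix (Fin n) (Fin n) ℝ) (hS : S.PosSemidef)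
    (g₀ g₁ : Matrix (Fin n) (Fin n) ℝ → EReal) (ψ : (Fin n → ℝ) → EReal)
    (hψ : Gamma0 ψ) (hg₀ : IsSpectral g₀ ψ) (hg₁ : Gamma0 g₁)
    (hdom : ∃ C : Matrix (Fin n) (Fin n) ℝ, logdetF σ C ≠ ⊤ ∧ g₀ C ≠ ⊤ ∧ g₁ C ≠ ⊤)
    (hcoer : ∀ M : ℝ, ∃ R : ℝ, ∀ C : Matrix (Fin n) (Fin n) ℝ, C.IsSymm →
      R ≤ frobNorm C → (M : EReal) ≤ logdetF σ C + g₀ C + g₁ C)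
    (C : ℕ → Matrix (Fin n) (Fin n) ℝ)
    (hC0 : (C 0).PosDef)
    (hE : {A : Matrix (Fin n) (Fin n) ℝ | A.IsSymm ∧
        logdetF σ A + traceTS σ S A + g₀ A + g₁ A
          ≤ logdetF σ (C 0) + traceTS σ S (C 0) + g₀ (C 0) + g₁ (C 0)}
      ⊆ intrinsicInterior ℝ
          ({A : Matrix (Fin n) (Fin n) ℝ | g₀ A ≠ ⊤} ∩ {A | g₁ A ≠ ⊤}))
    (hiter : ∀ l : ℕ, (C (l + 1)).IsSymm ∧
      ∀ A : Matrix (Fin n) (Fin n) ℝ, A.IsSymm →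
        logdetF σ (C (l + 1)) + (((gradTS σ S (C l) * C (l + 1)).trace : ℝ) : EReal)
            + g₀ (C (l + 1)) + g₁ (C (l + 1))
          ≤ logdetF σ A + (((gradTS σ S (C l) * A).trace : ℝ) : EReal) + g₀ A + g₁ A)
    (Fhat : ℝ)
    (hlim : Filter.Tendsto
      (fun l => logdetF σ (C l) + traceTS σ S (C l) + g₀ (C l) + g₁ (C l))
      Filter.atTop (nhds (Fhat : EReal))) :
    ∀ Chat : Matrix (Fin n) (Fin n) ℝ, MapClusterPt Chat Filter.atTop C →
      Chat.PosDef ∧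
      logdetF σ Chat + traceTS σ S Chat + g₀ Chat + g₁ Chat = (Fhat : EReal) ∧
      ∀ A : Matrix (Fin n) (Fin n) ℝ, A.IsSymm →
        g₀ Chat + g₁ Chat
            + ((((((Chat + σ ^ 2 • (Chat * Chat))⁻¹ - gradTS σ S Chat)
                * (A - Chat)).trace : ℝ)) : EReal)
          ≤ g₀ A + g₁ A := by
  intro Chat hcl
  have hG : ∀ A : MM n, A.IsSymm → g₀ A = GG ψ A := fun A hA => GG_eq g₀ ψ hψ hg₀ A hA
  have hb0 : ∀ A : MM n, A.IsSymm → g₀ A ≠ ⊥ := fun A hA => by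
    rw [hG A hA]; exact GG_ne_bot ψ hψ A
  have hb1 : ∀ A : MM n, g₁ A ≠ ⊥ := hg₁.1.2
  -- the iterates are finite
  have hfin : ∀ l, (C (l + 1)).PosDef ∧ ∃ p q : ℝ, g₀ (C (l + 1)) = p ∧ g₁ (C (l + 1)) = q := by
    intro l
    obtain ⟨A, h1, h2, h3⟩ := hdom
    have hA : A.PosDef := by
      by_contra h; exact h1 (by rw [logdetF, if_neg h])
    have hAs := pd_symm hA
    obtain ⟨a, ha⟩ := real_of h2 (hb0 A hAs)
    obtain ⟨b, hb⟩ := real_of h3 (hb1 A)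
    have hs := (hiter l).1
    have h := (hiter l).2 A hAs
    rw [logdetF_pd hA, ha, hb] at h
    have hlt : logdetF σ (C (l + 1)) + (((gradTS σ S (C l) * C (l + 1)).trace : ℝ) : EReal)
            + g₀ (C (l + 1)) + g₁ (C (l + 1)) ≠ ⊤ := by
      refine ne_top_of_le_ne_top ?_ h
      exact_mod_cast EReal.coe_ne_top _
    have hl0 : logdetF σ (C (l + 1)) ≠ ⊥ := by
      unfold logdetF; split_ifs
      · exact EReal.coe_ne_bot _
      · exact top_ne_bot
    have hx : logdetF σ (C (l + 1)) + (((gradTS σ S (C l) * C (l + 1)).trace : ℝ) : EReal) ≠ ⊥ := by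
      simp [EReal.add_eq_bot_iff, hl0]
    have hy : logdetF σ (C (l + 1)) + (((gradTS σ S (C l) * C (l + 1)).trace : ℝ) : EReal)
        + g₀ (C (l + 1)) ≠ ⊥ := by
      rw [Ne, EReal.add_eq_bot_iff]; push Not; exact ⟨hx, hb0 _ hs⟩
    have t1 : g₁ (C (l + 1)) ≠ ⊤ := fun h0 => hlt (by rw [h0, EReal.add_top_of_ne_bot hy])
    have hlt2 : logdetF σ (C (l + 1)) + (((gradTS σ S (C l) * C (l + 1)).trace : ℝ) : EReal)
        + g₀ (C (l + 1)) ≠ ⊤ := fun h0 => hlt (by rw [h0, EReal.top_add_of_ne_bot (hb1 _)])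
    have t0 : g₀ (C (l + 1)) ≠ ⊤ := fun h0 => hlt2 (by rw [h0, EReal.add_top_of_ne_bot hx])
    have hlt3 : logdetF σ (C (l + 1)) + (((gradTS σ S (C l) * C (l + 1)).trace : ℝ) : EReal) ≠ ⊤ :=
      fun h0 => hlt2 (by rw [h0, EReal.top_add_of_ne_bot (hb0 _ hs)])
    refine ⟨?_, ?_⟩
    · by_contra hnp
      exact hlt3 (by rw [logdetF, if_neg hnp, EReal.top_add_coe])
    · obtain ⟨p, hp⟩ := real_of t0 (hb0 _ hs)
      obtain ⟨q, hq⟩ := real_of t1 (hb1 _)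
      exact ⟨p, q, hp, hq⟩
  choose hpd p q hp hq using hfin
  -- key inequality
  have hkey : ∀ (l : ℕ) (A : MM n) (a b : ℝ), A.PosDef → g₀ A ≤ a → g₁ A ≤ b →
      lf σ (C (l + 1 + 1)) + tT σ S (C (l + 1 + 1)) + p (l + 1) + q (l + 1) ≤
        lf σ A + tT σ S (C (l + 1)) + (gradTS σ S (C (l + 1)) * (A - C (l + 1))).trace + a + b := by
    intro l A a b hA ha hb
    have h := (hiter (l + 1)).2 A (pd_symm hA)
    rw [logdetF_pd hA, logdetF_pd (hpd (l + 1)), hp (l + 1), hq (l + 1)] at h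
    have h' := h.trans (add_le_add (add_le_add le_rfl ha) hb)
    have h2 : lf σ (C (l + 1 + 1)) + (gradTS σ S (C (l + 1)) * C (l + 1 + 1)).trace
        + p (l + 1) + q (l + 1) ≤ lf σ A + (gradTS σ S (C (l + 1)) * A).trace + a + b := by
      exact_mod_cast h'
    have h3 := T_concave hσ hS (hpd (l + 1)).posSemidef (hpd l).posSemidef
    rw [mul_sub, Matrix.trace_sub] at h3 ⊢
    unfold tT
    linarith
  -- subsequence
  have : FirstCountableTopology (Matrix (Fin n) (Fin n) ℝ) :=
    inferInstanceAs (FirstCountableTopology (Fin n → Fin n → ℝ))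
  obtain ⟨φ, hφ, hφC⟩ := hcl.tendsto_subseq
  obtain ⟨ν, hν⟩ : ∃ ν : ℕ → ℕ, ∀ k, φ (k + 1) = ν k + 1 :=
    ⟨fun k => φ (k + 1) - 1, fun k => by
      have := hφ.id_le (k + 1)
      simp only [id] at this
      show φ (k + 1) = φ (k + 1) - 1 + 1
      omega⟩
  have hνC : Tendsto (fun k => C (ν k + 1)) atTop (𝓝 Chat) := by
    have := hφC.comp (tendsto_add_atTop_nat 1)
    refine this.congr fun k => ?_
    simp [Function.comp, hν]
  have hνt : Tendsto (fun k => ν k + 1) atTop atTop := by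
    have := hφ.tendsto_atTop.comp (tendsto_add_atTop_nat 1)
    refine this.congr fun k => ?_
    simp [Function.comp, hν]
  have hF : ∀ l, logdetF σ (C (l + 1)) + traceTS σ S (C (l + 1)) + g₀ (C (l + 1)) + g₁ (C (l + 1))
      = ((lf σ (C (l + 1)) + tT σ S (C (l + 1)) + p l + q l : ℝ) : EReal) := by
    intro l
    rw [logdetF_pd (hpd l), traceTS_psd (hpd l).posSemidef, hp, hq]
    push_cast; rfl
  have hF1 : Tendsto (fun k => lf σ (C (ν k + 1)) + tT σ S (C (ν k + 1)) + p (ν k) + q (ν k))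
      atTop (𝓝 Fhat) := by
    rw [← EReal.tendsto_coe]
    refine (hlim.comp hνt).congr fun k => ?_
    simp only [Function.comp, hF]
  have hF2 : Tendsto (fun k => lf σ (C (ν k + 1 + 1)) + tT σ S (C (ν k + 1 + 1))
      + p (ν k + 1) + q (ν k + 1)) atTop (𝓝 Fhat) := by
    rw [← EReal.tendsto_coe]
    refine (hlim.comp ((tendsto_add_atTop_nat 1).comp hνt)).congr fun k => ?_
    simp only [Function.comp, hF]
  -- the limit is positive semidefinite
  have hps : Chat.PosSemidef := psd_lim hνC fun k => (hpd (ν k)).posSemidef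
  have hsym : Chat.IsSymm := by
    have := hps.1
    rwa [Matrix.IsHermitian, Matrix.conjTranspose_eq_transpose_of_trivial] at this
  have hT := tendsto_tT (σ := σ) (S := S) hps hνC
  have hgr := tendsto_gr (σ := σ) (S := S) hps hνC
  have hH : LowerSemicontinuous (fun A : MM n => GG ψ A + g₁ A) := by
    refine LowerSemicontinuous.add' (GG_lsc ψ hψ) hg₁.2.1 fun A => ?_
    exact EReal.continuousAt_add (Or.inr (hb1 A)) (Or.inl (GG_ne_bot ψ hψ A))
  have hHk : ∀ k, GG ψ (C (ν k + 1)) + g₁ (C (ν k + 1)) = ((p (ν k) + q (ν k) : ℝ) : EReal) := by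
    intro k
    rw [← hG _ (hiter _).1, hp, hq]; push_cast; rfl
  have hHb : GG ψ Chat + g₁ Chat ≠ ⊥ := by
    rw [Ne, EReal.add_eq_bot_iff]; push Not; exact ⟨GG_ne_bot ψ hψ _, hb1 _⟩
  have hD := tendsto_det (tendsto_one_add (σ := σ) hνC)
  have hlD := hD.log (pd_one_add (σ := σ) hps).det_pos.ne'
  have hpdC : Chat.PosDef := by
    rw [hps.posDef_iff_det_ne_zero]
    obtain ⟨m, -, hm⟩ := EReal.lt_iff_exists_real_btwn.mp (bot_lt_iff_ne_bot.mpr hHb)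
    have hev := hνC.eventually (hH Chat m hm)
    have hw := ((hlD.sub ((hF1.sub hT).sub_const m))).rexp
    have := le_of_tendsto_of_tendsto hw (tendsto_det hνC) (hev.mono fun k hk => by
      have hk' : m < p (ν k) + q (ν k) := by
        simp only [hHk] at hk; exact_mod_cast hk
      beta_reduce
      rw [← Real.exp_log (hpd (ν k)).det_pos]
      apply Real.exp_le_exp.mpr
      have := lf_eq (σ := σ) (hpd (ν k))
      linarith)
    exact (lt_of_lt_of_le (Real.exp_pos _) this).ne'
  have hlf : Tendsto (fun k => lf σ (C (ν k + 1))) atTop (𝓝 (lf σ Chat)) := by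
    rw [lf_eq hpdC]
    refine (hlD.sub ((tendsto_det hνC).log hpdC.det_pos.ne')).congr fun k => ?_
    rw [lf_eq (hpd (ν k))]
  have hhk : Tendsto (fun k => p (ν k) + q (ν k)) atTop (𝓝 (Fhat - lf σ Chat - tT σ S Chat)) :=
    ((hF1.sub hlf).sub hT).congr fun k => by ring
  have hHle := lsc_le hH hνC hhk hHk
  have hHt : GG ψ Chat + g₁ Chat ≠ ⊤ := ne_top_of_le_ne_top (EReal.coe_ne_top _) hHle
  obtain ⟨ph, hph⟩ : ∃ r : ℝ, GG ψ Chat = r :=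
    real_of (fun h0 => hHt (by rw [h0, EReal.top_add_of_ne_bot (hb1 _)])) (GG_ne_bot ψ hψ _)
  obtain ⟨qh, hqh⟩ : ∃ r : ℝ, g₁ Chat = r :=
    real_of (fun h0 => hHt (by rw [h0, EReal.add_top_of_ne_bot (GG_ne_bot ψ hψ _)])) (hb1 _)
  have hle : ph + qh ≤ Fhat - lf σ Chat - tT σ S Chat := by
    rw [hph, hqh] at hHle; exact_mod_cast hHle
  have hg0h : g₀ Chat = ph := by rw [hG _ hsym, hph]
  -- limit of the key inequality
  have hlimkey : ∀ (A : MM n) (a b : ℝ), A.PosDef → g₀ A ≤ a → g₁ A ≤ b →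
      Fhat ≤ lf σ A + tT σ S Chat + (gradTS σ S Chat * (A - Chat)).trace + a + b := by
    intro A a b hA ha hb
    have h1 := tendsto_tr (hgr.mul (hνC.const_sub A))
    refine le_of_tendsto_of_tendsto' hF2 ((((hT.const_add (lf σ A)).add h1).add_const a).add_const b)
      fun k => ?_
    exact hkey (ν k) A a b hA ha hb
  have hge := hlimkey Chat ph qh hpdC hg0h.le hqh.le
  rw [sub_self, mul_zero, Matrix.trace_zero] at hge
  have hFeq : lf σ Chat + tT σ S Chat + ph + qh = Fhat := by linarith
  refine ⟨hpdC, ?_, ?_⟩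
  · rw [logdetF_pd hpdC, traceTS_psd hps, hg0h, hqh]
    exact_mod_cast hFeq
  intro A hA
  by_cases h0 : g₀ A = ⊤
  · rw [h0, EReal.top_add_of_ne_bot (hb1 A)]; exact le_top
  by_cases h1 : g₁ A = ⊤
  · rw [h1, EReal.add_top_of_ne_bot (hb0 A hA)]; exact le_top
  obtain ⟨a, ha⟩ := real_of h0 (hb0 A hA)
  obtain ⟨b, hb⟩ := real_of h1 (hb1 A)
  rw [ha, hb, hg0h, hqh]
  suffices h : ph + qh + (((Chat + σ ^ 2 • (Chat * Chat))⁻¹ - gradTS σ S Chat) * (A - Chat)).trace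
      ≤ a + b by exact_mod_cast h
  rw [sub_mul, Matrix.trace_sub]
  set D := A - Chat with hDd
  have hDs : D.IsSymm := hA.sub hsym
  obtain ⟨δ, hδ, hline⟩ := pd_line hpdC hDs
  have hder := (lf_line (σ := σ) hpdC D).tendsto_slope_zero_right
  have hev : ∀ᶠ t : ℝ in 𝓝[>] 0, t < min δ 1 :=
    (eventually_lt_nhds (lt_min hδ one_pos)).filter_mono nhdsWithin_le_nhds
  have hfinal := ge_of_tendsto (b := ph + qh - a - b - (gradTS σ S Chat * D).trace) hder (by
    filter_upwards [hev, self_mem_nhdsWithin] with t ht ht0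
    have ht0' : 0 < t := ht0
    have ht1 : t < 1 := ht.trans_le (min_le_right _ _)
    have hpt := hline t ht0'.le (ht.trans_le (min_le_left _ _))
    have hcomb : Chat + t • D = (1 - t) • Chat + t • A := by
      rw [hDd, smul_sub, sub_smul, one_smul]; abel
    have c0 : g₀ (Chat + t • D) ≤ (((1 - t) * ph + t * a : ℝ) : EReal) := by
      rw [hG _ (pd_symm hpt), hcomb]
      refine (GG_conv ψ hψ Chat A (1 - t) t (by linarith) ht0'.le (by ring)).trans ?_
      rw [hph, ← hG A hA, ha]
      exact_mod_cast le_rfl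
    have c1 : g₁ (Chat + t • D) ≤ (((1 - t) * qh + t * b : ℝ) : EReal) := by
      rw [hcomb]
      refine (hg₁.2.2 Chat A (1 - t) t (by linarith) ht0'.le (by ring)).trans ?_
      rw [hqh, hb]
      exact_mod_cast le_rfl
    have hk := hlimkey _ _ _ hpt c0 c1
    rw [add_sub_cancel_left, Matrix.mul_smul, Matrix.trace_smul, smul_eq_mul, lf_eq hpt] at hk
    rw [lf_eq hpdC] at hFeq
    simp only [zero_add, zero_smul, add_zero, smul_eq_mul]
    rw [← div_eq_inv_mul, le_div_iff₀ ht0']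
    linarith)
  linarith
end
end

section
/- Let n be a positive integer, γ > 0, μ > 0, and let C̄, T ∈ S_n. Let λ = (λ₁,…,λₙ) ∈ ℝⁿ and let U be an orthogonal matrix with C̄ + γT = U Diag(λ) Uᵀ. Then the function C ↦ γ(½‖C‖_F² − tr(TC) + μ‖C‖_*) + ½‖C − C̄‖_F², where ‖C‖_* denotes the nuclear norm of C ∈ S_n (the sum of the absolute values of its eigenvalues), has a unique minimizer over S_n, equal to U Diag((soft_{μγ/(γ+1)}(λᵢ/(γ+1)))₁≤ᵢ≤ₙ) Uᵀ, where soft_τ(ξ) = sign(ξ)·max(|ξ| − τ, 0) is the soft-thresholding operator with parameter τ ≥ 0. -/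
open Matrix

noncomputable section

open scoped Classical

/-- Nuclear norm of a symmetric real matrix: the sum of the absolute values of its eigenvalues. -/
def nuclearNorm {n : ℕ} (C : Matrix (Fin n) (Fin n) ℝ) : ℝ :=
  if h : C.IsHermitian then ∑ i, |h.eigenvalues i| else 0

/-- The soft-thresholding operator with parameter `τ`. -/
def soft (τ ξ : ℝ) : ℝ := Real.sign ξ * max (|ξ| - τ) 0

lemma frobSq_eq {n : ℕ} (A : Matrix (Fin n) (Fin n) ℝ) (hA : A.IsSymm) :
    frobSq A = (A * A).trace := by
  simp only [frobSq, Matrix.trace, Matrix.diag_apply, Matrix.mul_apply]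
  refine Finset.sum_congr rfl fun i _ => Finset.sum_congr rfl fun j _ => ?_
  rw [hA.apply i j]; ring

lemma spec_exists {n : ℕ} (C : Matrix (Fin n) (Fin n) ℝ) (hC : C.IsSymm) :
    ∃ (V : Matrix (Fin n) (Fin n) ℝ) (e : Fin n → ℝ), Vᵀ * V = 1 ∧ V * Vᵀ = 1 ∧
      C = V * Matrix.diagonal e * Vᵀ ∧ nuclearNorm C = ∑ i, |e i| := by
  have h : C.IsHermitian := by
    rw [Matrix.IsHermitian, Matrix.conjTranspose_eq_transpose_of_trivial]; exact hC
  have h1 : (h.eigenvectorUnitary : Matrix (Fin n) (Fin n) ℝ)ᵀ * h.eigenvectorUnitary = 1 := by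
    have := Unitary.coe_star_mul_self h.eigenvectorUnitary
    rwa [Matrix.star_eq_conjTranspose, Matrix.conjTranspose_eq_transpose_of_trivial] at this
  refine ⟨h.eigenvectorUnitary, h.eigenvalues, h1, mul_eq_one_comm.mp h1, ?_, ?_⟩
  · have := h.spectral_theorem
    rw [Unitary.conjStarAlgAut_apply, Matrix.star_eq_conjTranspose,
      Matrix.conjTranspose_eq_transpose_of_trivial] at this
    exact this
  · rw [nuclearNorm, dif_pos h]

lemma diag_conj {n : ℕ} (W : Matrix (Fin n) (Fin n) ℝ) (g : Fin n → ℝ) (i : Fin n) :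
    (Wᵀ * Matrix.diagonal g * W) i i = ∑ k, W k i ^ 2 * g k := by
  rw [Matrix.mul_apply]
  refine Finset.sum_congr rfl fun k _ => ?_
  rw [Matrix.mul_diagonal, Matrix.transpose_apply]; ring

lemma col_sum {n : ℕ} (W : Matrix (Fin n) (Fin n) ℝ) (h : Wᵀ * W = 1) (i : Fin n) :
    ∑ k, W k i ^ 2 = 1 := by
  have := congrFun (congrFun h i) i
  rw [Matrix.mul_apply, Matrix.one_apply_eq] at this
  rw [← this]
  exact Finset.sum_congr rfl fun k _ => by rw [Matrix.transpose_apply]; ring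

lemma nuc_le {n : ℕ} (U : Matrix (Fin n) (Fin n) ℝ) (s : Fin n → ℝ) (hU : Uᵀ * U = 1)
    (hS : (U * Matrix.diagonal s * Uᵀ).IsSymm) :
    nuclearNorm (U * Matrix.diagonal s * Uᵀ) ≤ ∑ i, |s i| := by
  obtain ⟨V, e, h1, h2, h3, h4⟩ := spec_exists _ hS
  have hU' : U * Uᵀ = 1 := mul_eq_one_comm.mp hU
  rw [h4]
  have hW : (Uᵀ * V) * (Uᵀ * V)ᵀ = 1 := by
    rw [Matrix.transpose_mul, Matrix.transpose_transpose]
    calc Uᵀ * V * (Vᵀ * U) = Uᵀ * (V * Vᵀ) * U := by simp only [Matrix.mul_assoc]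
      _ = 1 := by rw [h2, Matrix.mul_one, hU]
  have hd : Matrix.diagonal e = (Uᵀ * V)ᵀ * Matrix.diagonal s * (Uᵀ * V) := by
    rw [Matrix.transpose_mul, Matrix.transpose_transpose]
    calc Matrix.diagonal e = (Vᵀ * V) * Matrix.diagonal e * (Vᵀ * V) := by simp [h1]
      _ = Vᵀ * (V * Matrix.diagonal e * Vᵀ) * V := by simp only [Matrix.mul_assoc]
      _ = Vᵀ * (U * Matrix.diagonal s * Uᵀ) * V := by rw [h3]
      _ = _ := by simp only [Matrix.mul_assoc]
  generalize Uᵀ * V = W at hW hd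
  have he : ∀ i, e i = ∑ k, W k i ^ 2 * s k := fun i => by
    rw [← diag_conj, ← hd, Matrix.diagonal_apply_eq]
  calc ∑ i, |e i| ≤ ∑ i, ∑ k, W k i ^ 2 * |s k| := by
        refine Finset.sum_le_sum fun i _ => ?_
        rw [he]
        refine (Finset.abs_sum_le_sum_abs _ _).trans_eq (Finset.sum_congr rfl fun k _ => ?_)
        rw [abs_mul, abs_of_nonneg (sq_nonneg _)]
    _ = ∑ k, ∑ i, W k i ^ 2 * |s k| := Finset.sum_comm
    _ = ∑ k, |s k| := by
        refine Finset.sum_congr rfl fun k _ => ?_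
        rw [← Finset.sum_mul]
        have := col_sum Wᵀ (by rwa [Matrix.transpose_transpose]) k
        simp only [Matrix.transpose_apply] at this
        rw [this, one_mul]

lemma tr_le {n : ℕ} (C U : Matrix (Fin n) (Fin n) ℝ) (g : Fin n → ℝ) (m : ℝ)
    (hU : Uᵀ * U = 1) (hC : C.IsSymm) (hg : ∀ i, |g i| ≤ m) :
    (C * (U * Matrix.diagonal g * Uᵀ)).trace ≤ m * nuclearNorm C := by
  obtain ⟨V, e, h1, h2, h3, h4⟩ := spec_exists _ hC
  have hU' : U * Uᵀ = 1 := mul_eq_one_comm.mp hU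
  rw [h4]
  have hW : (Uᵀ * V)ᵀ * (Uᵀ * V) = 1 := by
    rw [Matrix.transpose_mul, Matrix.transpose_transpose]
    calc Vᵀ * U * (Uᵀ * V) = Vᵀ * (U * Uᵀ) * V := by simp only [Matrix.mul_assoc]
      _ = 1 := by rw [hU', Matrix.mul_one, h1]
  have ht : (C * (U * Matrix.diagonal g * Uᵀ)).trace =
      (Matrix.diagonal e * ((Uᵀ * V)ᵀ * Matrix.diagonal g * (Uᵀ * V))).trace := by
    rw [Matrix.transpose_mul, Matrix.transpose_transpose, h3]
    rw [show V * Matrix.diagonal e * Vᵀ * (U * Matrix.diagonal g * Uᵀ) =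
      V * (Matrix.diagonal e * Vᵀ * (U * Matrix.diagonal g * Uᵀ)) by simp only [Matrix.mul_assoc],
      Matrix.trace_mul_comm]
    simp only [Matrix.mul_assoc]
  rw [ht]
  generalize Uᵀ * V = W at hW
  simp only [Matrix.trace, Matrix.diag_apply, Matrix.diagonal_mul, diag_conj]
  rw [Finset.mul_sum]
  refine Finset.sum_le_sum fun i _ => ?_
  have hb : |∑ k, W k i ^ 2 * g k| ≤ m := by
    calc |∑ k, W k i ^ 2 * g k| ≤ ∑ k, W k i ^ 2 * m := by
          refine (Finset.abs_sum_le_sum_abs _ _).trans (Finset.sum_le_sum fun k _ => ?_)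
          rw [abs_mul, abs_of_nonneg (sq_nonneg _)]
          exact mul_le_mul_of_nonneg_left (hg k) (sq_nonneg _)
      _ = m := by rw [← Finset.sum_mul, col_sum W hW, one_mul]
  calc _ ≤ |e i * ∑ k, W k i ^ 2 * g k| := le_abs_self _
    _ = |e i| * |∑ k, W k i ^ 2 * g k| := abs_mul _ _
    _ ≤ |e i| * m := mul_le_mul_of_nonneg_left hb (abs_nonneg _)
    _ = _ := mul_comm _ _

lemma soft_facts (τ ξ : ℝ) (hτ : 0 ≤ τ) :
    |ξ - soft τ ξ| ≤ τ ∧ soft τ ξ * (ξ - soft τ ξ) = τ * |soft τ ξ| := by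
  unfold soft
  rcases le_total (|ξ| - τ) 0 with h | h
  · rw [max_eq_right h]; simp; linarith
  · rw [max_eq_left h]
    rcases lt_trichotomy ξ 0 with h' | h' | h'
    · rw [abs_of_neg h'] at *
      rw [Real.sign_of_neg h', show ξ - -1 * (-ξ - τ) = -τ by ring, abs_neg, abs_of_nonneg hτ,
        abs_mul, abs_of_nonneg h]
      refine ⟨le_rfl, ?_⟩
      norm_num; ring
    · subst h'; simp at *; linarith
    · rw [abs_of_pos h'] at *
      rw [Real.sign_of_pos h', show ξ - 1 * (ξ - τ) = τ by ring, abs_of_nonneg hτ,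
        abs_mul, abs_of_nonneg h]
      refine ⟨le_rfl, ?_⟩
      norm_num; ring

lemma conj_symm {n : ℕ} (U : Matrix (Fin n) (Fin n) ℝ) (s : Fin n → ℝ) :
    (U * Matrix.diagonal s * Uᵀ).IsSymm := by
  rw [Matrix.IsSymm]
  simp [Matrix.transpose_mul, Matrix.mul_assoc]

lemma tr_conj {n : ℕ} (U : Matrix (Fin n) (Fin n) ℝ) (s g : Fin n → ℝ) (hU : Uᵀ * U = 1) :
    ((U * Matrix.diagonal s * Uᵀ) * (U * Matrix.diagonal g * Uᵀ)).trace = ∑ i, s i * g i := by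
  rw [show (U * Matrix.diagonal s * Uᵀ) * (U * Matrix.diagonal g * Uᵀ) =
    U * (Matrix.diagonal s * (Uᵀ * U) * (Matrix.diagonal g * Uᵀ)) by simp only [Matrix.mul_assoc],
    hU, Matrix.trace_mul_comm, Matrix.mul_one]
  rw [show Matrix.diagonal s * (Matrix.diagonal g * Uᵀ) * U =
    Matrix.diagonal s * Matrix.diagonal g * (Uᵀ * U) by simp only [Matrix.mul_assoc], hU]
  simp [Matrix.trace]

/-- Objective. -/
def objF {n : ℕ} (γ μ : ℝ) (T Cbar C : Matrix (Fin n) (Fin n) ℝ) : ℝ :=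
  γ * (frobSq C / 2 - (T * C).trace + μ * nuclearNorm C) + frobSq (C - Cbar) / 2

lemma key {n : ℕ} (γ μ : ℝ) (hγ : 0 < γ) (hμ : 0 < μ)
    (Cbar T : Matrix (Fin n) (Fin n) ℝ) (hCbar : Cbar.IsSymm)
    (lam : Fin n → ℝ) (U : Matrix (Fin n) (Fin n) ℝ) (hU : Uᵀ * U = 1)
    (hdec : Cbar + γ • T = U * Matrix.diagonal lam * Uᵀ)
    (C : Matrix (Fin n) (Fin n) ℝ) (hC : C.IsSymm) (S : Matrix (Fin n) (Fin n) ℝ)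
    (hS : S = U * Matrix.diagonal (fun i => soft (μ * γ / (γ + 1)) (lam i / (γ + 1))) * Uᵀ) :
    objF γ μ T Cbar S + (γ + 1) / 2 * frobSq (C - S) ≤ objF γ μ T Cbar C := by
  set s : Fin n → ℝ := fun i => soft (μ * γ / (γ + 1)) (lam i / (γ + 1)) with hs
  set g : Fin n → ℝ := fun i => lam i - (γ + 1) * s i with hg
  have h1 : (0:ℝ) < γ + 1 := by linarith
  have hτ : 0 ≤ μ * γ / (γ + 1) := by positivity
  have hlam : ∀ i, g i = (γ + 1) * (lam i / (γ + 1) - s i) := fun i => by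
    simp only [hg]; field_simp
  have hgb : ∀ i, |g i| ≤ γ * μ := fun i => by
    rw [hlam, abs_mul, abs_of_pos h1]
    calc _ ≤ (γ + 1) * (μ * γ / (γ + 1)) :=
          mul_le_mul_of_nonneg_left (soft_facts _ _ hτ).1 h1.le
      _ = γ * μ := by field_simp
  have hsg : ∀ i, s i * g i = γ * μ * |s i| := fun i => by
    rw [hlam]
    calc _ = (γ + 1) * (s i * (lam i / (γ + 1) - s i)) := by ring
      _ = (γ + 1) * (μ * γ / (γ + 1) * |s i|) := by rw [(soft_facts _ _ hτ).2]
      _ = _ := by field_simp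
  have hSs : S.IsSymm := hS ▸ conj_symm U s
  have hG : U * Matrix.diagonal g * Uᵀ = Cbar + γ • T - (γ + 1) • S := by
    rw [hdec, hS, show Matrix.diagonal g = Matrix.diagonal lam - (γ + 1) • Matrix.diagonal s by
      rw [← Matrix.diagonal_smul, Matrix.diagonal_sub]; rfl]
    simp [Matrix.mul_sub, Matrix.sub_mul]
  have hA := tr_le C U g (γ * μ) hU hC hgb
  have hB : γ * μ * nuclearNorm S ≤ (S * (U * Matrix.diagonal g * Uᵀ)).trace := by
    have h2 := nuc_le U s hU (conj_symm U s)
    rw [hS, tr_conj U s g hU, Finset.sum_congr rfl fun i _ => hsg i, ← Finset.mul_sum]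
    exact mul_le_mul_of_nonneg_left h2 (by positivity)
  rw [hG] at hA hB
  unfold objF
  rw [frobSq_eq _ hC, frobSq_eq _ hSs, frobSq_eq _ (hC.sub hSs), frobSq_eq _ (hC.sub hCbar),
    frobSq_eq _ (hSs.sub hCbar)]
  simp only [Matrix.mul_add, Matrix.mul_sub, Matrix.sub_mul, Matrix.mul_smul, Matrix.trace_add,
    Matrix.trace_sub, Matrix.trace_smul, smul_eq_mul] at hA hB ⊢
  rw [Matrix.trace_mul_comm T C, Matrix.trace_mul_comm T S, Matrix.trace_mul_comm Cbar C,
    Matrix.trace_mul_comm Cbar S, Matrix.trace_mul_comm S C]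
  linarith

lemma frobSq_nonneg {n : ℕ} (A : Matrix (Fin n) (Fin n) ℝ) : 0 ≤ frobSq A :=
  Finset.sum_nonneg fun _ _ => Finset.sum_nonneg fun _ _ => sq_nonneg _

lemma frobSq_zero {n : ℕ} (A : Matrix (Fin n) (Fin n) ℝ) (h : frobSq A ≤ 0) : A = 0 := by
  have h0 := le_antisymm h (frobSq_nonneg A)
  have h1 := (Finset.sum_eq_zero_iff_of_nonneg (s := Finset.univ) (f := fun i => ∑ j, A i j ^ 2)
    fun _ _ => Finset.sum_nonneg fun _ _ => sq_nonneg _).mp h0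
  ext i j
  have h2 := (Finset.sum_eq_zero_iff_of_nonneg (s := Finset.univ) (f := fun j => A i j ^ 2)
    fun _ _ => sq_nonneg _).mp (h1 i (Finset.mem_univ _)) j (Finset.mem_univ _)
  simpa using h2

/-- The objective `C ↦ γ(½‖C‖_F² − tr(TC) + μ‖C‖_*) + ½‖C − C̄‖_F²` has the
unique minimizer `U Diag(soft_{μγ/(γ+1)}(λᵢ/(γ+1))) Uᵀ` over symmetric matrices, where
`C̄ + γT = U Diag(λ) Uᵀ` with `U` orthogonal. -/
theorem stmt18 (n : ℕ) (hn : 0 < n) (γ μ : ℝ) (hγ : 0 < γ) (hμ : 0 < μ)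
    (Cbar T : Matrix (Fin n) (Fin n) ℝ) (hCbar : Cbar.IsSymm) (hT : T.IsSymm)
    (lam : Fin n → ℝ) (U : Matrix (Fin n) (Fin n) ℝ) (hU : IsOrth U)
    (hdec : Cbar + γ • T = U * Matrix.diagonal lam * Uᵀ) :
    (U * Matrix.diagonal (fun i => soft (μ * γ / (γ + 1)) (lam i / (γ + 1))) * Uᵀ).IsSymm ∧
    (∀ C : Matrix (Fin n) (Fin n) ℝ, C.IsSymm →
      γ * (frobSq (U * Matrix.diagonal (fun i => soft (μ * γ / (γ + 1)) (lam i / (γ + 1))) * Uᵀ) / 2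
            - (T * (U * Matrix.diagonal (fun i => soft (μ * γ / (γ + 1)) (lam i / (γ + 1))) * Uᵀ)).trace
            + μ * nuclearNorm (U * Matrix.diagonal (fun i => soft (μ * γ / (γ + 1)) (lam i / (γ + 1))) * Uᵀ))
          + frobSq (U * Matrix.diagonal (fun i => soft (μ * γ / (γ + 1)) (lam i / (γ + 1))) * Uᵀ - Cbar) / 2
        ≤ γ * (frobSq C / 2 - (T * C).trace + μ * nuclearNorm C) + frobSq (C - Cbar) / 2) ∧
    (∀ C : Matrix (Fin n) (Fin n) ℝ, C.IsSymm →
      (∀ C' : Matrix (Fin n) (Fin n) ℝ, C'.IsSymm →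
        γ * (frobSq C / 2 - (T * C).trace + μ * nuclearNorm C) + frobSq (C - Cbar) / 2
          ≤ γ * (frobSq C' / 2 - (T * C').trace + μ * nuclearNorm C') + frobSq (C' - Cbar) / 2) →
      C = U * Matrix.diagonal (fun i => soft (μ * γ / (γ + 1)) (lam i / (γ + 1))) * Uᵀ) := by
  have hK := fun C hC => key γ μ hγ hμ Cbar T hCbar lam U hU hdec C hC _ rfl
  have h1 : (0:ℝ) < γ + 1 := by linarith
  refine ⟨conj_symm _ _, fun C hC => ?_, fun C hC hmin => ?_⟩
  · have h2 := hK C hC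
    have h3 := mul_nonneg (half_pos h1).le (frobSq_nonneg
      (C - U * Matrix.diagonal (fun i => soft (μ * γ / (γ + 1)) (lam i / (γ + 1))) * Uᵀ))
    unfold objF at h2
    linarith
  · have h2 := hK C hC
    have h3 := hmin _ (conj_symm U (fun i => soft (μ * γ / (γ + 1)) (lam i / (γ + 1))))
    unfold objF at h2
    refine sub_eq_zero.mp (frobSq_zero _ ?_)
    by_contra! h
    have := mul_pos (half_pos h1) h
    linarith
end
end
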